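/- arXiv:2111.12171 — 2 statements merged into one kernel-verified Lean document; each statement's English description precedes it below -/
import Mathlib

section
/- Let 0 < ε < 1 and let g : ℝ → ℝ → ℝ be such that g(0, θ) = θ for all θ, for each θ the map s ↦ g(s, θ) is infinitely differentiable on (−ε, ε), and f(s, g(s, θ)) = θ for all θ ∈ ℝ and all s with |s| < ε, where f(s, φ) = (π/2) · (∫₀^φ (1 − s·sin²τ)^(−1/2) dτ) / (∫₀^{π/2} (1 − s·sin²τ)^(−1/2) dτ). Then for all integers j ≥ 1 and k ≥ 1, (1/(π · j!)) · ∫_{−π}^{π} (∂_s^j [cos(k · g(s, θ))])(0, θ) · cos((k + 2j)θ) dθ = 2^{−4j} · binomial(k + j − 1, j). -/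
open Real MeasureTheory intervalIntegral ContDiff

/-- The action-angle coordinate `θ` as a function of the elliptic coordinate `φ`
and the caustic parameter `s = k_λ²`. -/
noncomputable def actionAngle (s φ : ℝ) : ℝ :=
  (π / 2) * (∫ τ in (0:ℝ)..φ, (1 - s * Real.sin τ ^ 2) ^ (-(1:ℝ)/2)) /
    (∫ τ in (0:ℝ)..(π/2), (1 - s * Real.sin τ ^ 2) ^ (-(1:ℝ)/2))

open Filter Topology Asymptotics

theorem hasDerivAt_parametric_integral {H : ℝ × ℝ → ℝ} (hH : ContDiff ℝ 1 H) (a b s : ℝ) :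
    HasDerivAt (fun s => ∫ τ in a..b, H (s, τ)) (∫ τ in a..b, fderiv ℝ H (s, τ) (1, 0)) s := by
  have hcont : Continuous fun p => fderiv ℝ H p (1, 0) :=
    (hH.continuous_fderiv one_ne_zero).clm_apply continuous_const
  obtain ⟨M, hM⟩ := ((isCompact_Icc (a := s - 1) (b := s + 1)).prod
    (isCompact_uIcc (a := a) (b := b))).exists_bound_of_continuousOn hcont.continuousOn
  refine (intervalIntegral.hasDerivAt_integral_of_dominated_loc_of_deriv_le
    (bound := fun _ => M) (F' := fun s τ => fderiv ℝ H (s, τ) (1, 0))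
    (Icc_mem_nhds (sub_one_lt s) (lt_add_one s)) ?_ ?_ ?_ ?_ ?_ ?_).2
  · exact Eventually.of_forall fun x =>
      (hH.continuous.comp (by fun_prop : Continuous fun τ : ℝ => (x, τ))).aestronglyMeasurable
  · exact (hH.continuous.comp (by fun_prop : Continuous fun τ : ℝ => (s, τ))).intervalIntegrable _ _
  · exact (hcont.comp (by fun_prop : Continuous fun τ : ℝ => (s, τ))).aestronglyMeasurable
  · exact Eventually.of_forall fun t ht x hx => hM (x, t) ⟨hx, Set.uIoc_subset_uIcc ht⟩
  · simp
  · refine Eventually.of_forall fun t _ x _ => ?_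
    exact ((hH.differentiable one_ne_zero (x, t)).hasFDerivAt.comp_hasDerivAt x
      ((hasDerivAt_id x).prodMk (hasDerivAt_const x t)))

/-- A primitive in the second variable of a smooth function of two variables is smooth. -/
theorem contDiff_parametric_primitive {H : ℝ × ℝ → ℝ} {n : ℕ} (hH : ContDiff ℝ n H) :
    ContDiff ℝ n (fun p : ℝ × ℝ => ∫ τ in (0:ℝ)..p.2, H (p.1, τ)) := by
  induction n generalizing H with
  | zero =>
    rw [Nat.cast_zero, contDiff_zero] at *
    exact intervalIntegral.continuous_parametric_intervalIntegral_of_continuous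
      (f := fun (p : ℝ × ℝ) τ => H (p.1, τ)) (by fun_prop) continuous_snd
  | succ n ih =>
    have hH1 : ContDiff ℝ 1 H := hH.of_le (by simp)
    have hHs : ContDiff ℝ n fun p => fderiv ℝ H p (1, 0) :=
      (hH.fderiv_right (m := n) (by simp)).clm_apply contDiff_const
    have hHn : ContDiff ℝ n H := hH.of_le (by simp)
    rw [Nat.cast_add, Nat.cast_one, contDiff_succ_iff_hasFDerivAt (n := n)]
    let A₁ : ℝ → ℝ → ℝ →L[ℝ] ℝ := fun s φ =>
      ContinuousLinearMap.toSpanSingleton ℝ (∫ τ in (0:ℝ)..φ, fderiv ℝ H (s, τ) (1, 0))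
    let A₂ : ℝ → ℝ → ℝ →L[ℝ] ℝ := fun s φ => ContinuousLinearMap.toSpanSingleton ℝ (H (s, φ))
    have hA₁ : ContDiff ℝ n ↿A₁ :=
      (ContinuousLinearMap.toSpanSingletonCLE (𝕜 := ℝ) (E := ℝ)).contDiff.comp (ih hHs)
    have hA₂ : ContDiff ℝ n ↿A₂ :=
      (ContinuousLinearMap.toSpanSingletonCLE (𝕜 := ℝ) (E := ℝ)).contDiff.comp hHn
    refine ⟨fun p => (A₁ p.1 p.2).coprod (A₂ p.1 p.2), ?_, fun p => ?_⟩
    · exact (ContinuousLinearMap.coprodEquivL (𝕜 := ℝ) (E := ℝ) (F := ℝ) (G := ℝ) ℝ).contDiff.comp (hA₁.prodMk hA₂)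
    · refine (hasStrictFDerivAt_uncurry_coprod (f := fun s φ => ∫ τ in (0:ℝ)..φ, H (s, τ))
        (Eventually.of_forall fun v => ?_) (Eventually.of_forall fun v => ?_)
        hA₁.continuous.continuousAt hA₂.continuous.continuousAt).hasFDerivAt
      · exact (hasDerivAt_parametric_integral hH1 0 v.2 v.1).hasFDerivAt
      · have hc : Continuous fun τ => H (v.1, τ) := by fun_prop
        exact (intervalIntegral.integral_hasDerivAt_right (hc.intervalIntegrable _ _)
          hc.stronglyMeasurable.stronglyMeasurableAtFilter hc.continuousAt).hasFDerivAt

theorem iteratedDeriv_parametric_integral {H : ℝ × ℝ → ℝ} (hH : ContDiff ℝ ∞ H) (a b : ℝ)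
    (j : ℕ) (s : ℝ) :
    iteratedDeriv j (fun s => ∫ τ in a..b, H (s, τ)) s =
      ∫ τ in a..b, iteratedDeriv j (fun s => H (s, τ)) s := by
  induction j generalizing H with
  | zero => simp
  | succ j ih =>
    have h1 : ContDiff ℝ 1 H := hH.of_le (by simp)
    have hHs : ContDiff ℝ ∞ fun p => fderiv ℝ H p (1, 0) :=
      (hH.fderiv_right (m := ∞) (by simp)).clm_apply contDiff_const
    have hd : ∀ τ, deriv (fun s => H (s, τ)) = fun s => fderiv ℝ H (s, τ) (1, 0) := fun τ =>
      funext fun x => ((h1.differentiable one_ne_zero (x, τ)).hasFDerivAt.comp_hasDerivAt x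
        ((hasDerivAt_id x).prodMk (hasDerivAt_const x τ))).deriv
    simp_rw [iteratedDeriv_succ', hd]
    rw [← ih hHs]
    congr 1
    exact funext fun s => (hasDerivAt_parametric_integral h1 a b s).deriv

theorem contDiff_parametric_integral {H : ℝ × ℝ → ℝ} {n : ℕ} (hH : ContDiff ℝ n H) (a b : ℝ) :
    ContDiff ℝ n (fun s => ∫ τ in a..b, H (s, τ)) := by
  have h : ∀ c : ℝ, ContDiff ℝ n (fun s => ∫ τ in (0:ℝ)..c, H (s, τ)) := fun c =>
    (contDiff_parametric_primitive hH).comp (contDiff_id.prodMk contDiff_const)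
  convert (h b).sub (h a) using 2 with s
  have hc : Continuous fun τ => H (s, τ) := hH.continuous.comp (by fun_prop)
  exact (intervalIntegral.integral_interval_sub_left
    (hc.intervalIntegrable _ _) (hc.intervalIntegrable _ _)).symm

theorem coeff_eq_of_tendsto_div_pow {j : ℕ} {c : ℕ → ℝ} {L : ℝ}
    (h : Tendsto (fun s : ℝ => (∑ i ∈ Finset.range (j + 1), c i * s ^ i) / s ^ j) (𝓝[≠] 0) (𝓝 L)) :
    c j = L := by
  induction j generalizing c with
  | zero =>
    simp only [zero_add, Finset.range_one, Finset.sum_singleton, pow_zero, mul_one, div_one] at h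
    exact tendsto_nhds_unique tendsto_const_nhds h
  | succ j ih =>
    have hs : Tendsto (fun s : ℝ => s ^ (j + 1)) (𝓝[≠] 0) (𝓝 0) :=
      ((continuous_pow (j + 1)).tendsto' 0 0 (by simp)).mono_left nhdsWithin_le_nhds
    have h0 := h.mul hs
    have hc0 : c 0 = 0 := by
      have hsum : Tendsto (fun s : ℝ => ∑ i ∈ Finset.range (j + 1 + 1), c i * s ^ i) (𝓝[≠] 0)
          (𝓝 (c 0)) := by
        refine Tendsto.mono_left (Continuous.tendsto' (by fun_prop) 0 _ ?_) nhdsWithin_le_nhds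
        rw [Finset.sum_range_succ']
        simp
      refine tendsto_nhds_unique hsum ((h0.congr' ?_).trans (by simp))
      filter_upwards [self_mem_nhdsWithin] with s (hs : s ≠ 0)
      field_simp
    refine ih (c := fun i => c (i + 1)) (h.congr' ?_)
    filter_upwards [self_mem_nhdsWithin] with s (hs : s ≠ 0)
    rw [Finset.sum_range_succ', hc0, zero_mul, add_zero, pow_succ]
    simp_rw [pow_succ, ← mul_assoc, ← Finset.sum_mul]
    field_simp

theorem iteratedDeriv_eq_of_tendsto_div_pow {F : ℝ → ℝ} {j : ℕ} {L : ℝ} (hF : ContDiff ℝ j F)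
    (h : Tendsto (fun s : ℝ => F s / s ^ j) (𝓝[≠] 0) (𝓝 L)) :
    iteratedDeriv j F 0 = j.factorial * L := by
  have ht := Real.taylor_tendsto (x₀ := 0) convex_univ (Set.mem_univ 0) hF.contDiffOn
  rw [nhdsWithin_univ] at ht
  have h2 := h.sub (ht.mono_left nhdsWithin_le_nhds)
  have := coeff_eq_of_tendsto_div_pow (j := j)
    (c := fun i => iteratedDeriv i F 0 / i.factorial) (L := L) ((h2.congr fun s => ?_).trans (by simp))
  · rw [← this]
    field_simp
  · rw [sub_zero, ← sub_div, sub_sub_cancel, taylor_within_apply]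
    congr 1
    refine Finset.sum_congr rfl fun i _ => ?_
    simp [iteratedDerivWithin_univ]
    ring
section Recurrence

variable {m : ℕ} {C : ℝ → ℝ} {I : ℕ → ℝ → ℝ}

theorem eventually_eq_of_recurrence (hC : Tendsto C (𝓝[≠] 0) (𝓝 1))
    (hrec : ∀ k, ∀ᶠ s in 𝓝[≠] (0:ℝ), (m:ℝ) ^ 2 * I k s = C s ^ 2 * (k ^ 2 * (1 - s / 2) * I k s +
      k * (k + 1) * s / 4 * I (k + 2) s + k * (k - 1) * s / 4 * I (k - 2) s))
    {k : ℕ} (hk : k < m) :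
    ∃ Q : ℝ → ℝ, Tendsto Q (𝓝[≠] 0) (𝓝 (4 * ((m:ℝ) ^ 2 - k ^ 2))⁻¹) ∧ ∀ᶠ s in 𝓝[≠] (0:ℝ),
      I k s = Q s * (s * (k * (k + 1) * I (k + 2) s + k * (k - 1) * I (k - 2) s)) := by
  have hkm : (k:ℝ) < m := by exact_mod_cast hk
  have hne : 4 * ((m:ℝ) ^ 2 - k ^ 2) ≠ 0 := by
    have : (0:ℝ) ≤ k := k.cast_nonneg
    nlinarith
  have hid : Tendsto (fun s : ℝ => s) (𝓝[≠] 0) (𝓝 0) := tendsto_id.mono_left nhdsWithin_le_nhds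
  have hP : Tendsto (fun s => 4 * ((m:ℝ) ^ 2 - C s ^ 2 * (k ^ 2 * (1 - s / 2)))) (𝓝[≠] 0)
      (𝓝 (4 * ((m:ℝ) ^ 2 - k ^ 2))) := by
    convert ((hC.pow 2).mul (((hid.div_const 2).const_sub 1).const_mul ((k:ℝ) ^ 2))).const_sub
      ((m:ℝ) ^ 2) |>.const_mul 4 using 2
    simp
  refine ⟨fun s => (4 * ((m:ℝ) ^ 2 - C s ^ 2 * (k ^ 2 * (1 - s / 2))))⁻¹ * C s ^ 2, ?_, ?_⟩
  · simpa using (hP.inv₀ hne).mul (hC.pow 2)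
  · filter_upwards [hrec k, hP.eventually_ne hne] with s h1 h2
    rw [mul_assoc, eq_inv_mul_iff_mul_eq₀ h2]
    linear_combination 4 * h1

theorem isBigO_of_recurrence (hC : Tendsto C (𝓝[≠] 0) (𝓝 1))
    (hbdd : ∀ k, I k =O[𝓝[≠] 0] (fun _ => (1:ℝ)))
    (hrec : ∀ k, ∀ᶠ s in 𝓝[≠] (0:ℝ), (m:ℝ) ^ 2 * I k s = C s ^ 2 * (k ^ 2 * (1 - s / 2) * I k s +
      k * (k + 1) * s / 4 * I (k + 2) s + k * (k - 1) * s / 4 * I (k - 2) s))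
    (d k : ℕ) (hk : k + 2 * d ≤ m) : I k =O[𝓝[≠] 0] (fun s => s ^ d) := by
  induction d generalizing k with
  | zero => simpa using hbdd k
  | succ d ih =>
    obtain ⟨Q, hQ, h⟩ := eventually_eq_of_recurrence hC hrec (show k < m by omega)
    have hlow : (fun s => (k:ℝ) * (k - 1) * I (k - 2) s) =O[𝓝[≠] 0] (fun s => s ^ d) :=
      (ih (k - 2) (by omega)).const_mul_left _
    have hup : (fun s => (k:ℝ) * (k + 1) * I (k + 2) s) =O[𝓝[≠] 0] (fun s => s ^ d) :=
      (ih (k + 2) (by omega)).const_mul_left _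
    refine IsBigO.congr' ((hQ.isBigO_one ℝ).mul ((isBigO_refl (fun s : ℝ => s) _).mul
      (hup.add hlow))) (h.mono fun s hs => hs.symm) (Eventually.of_forall fun s => ?_)
    simp only [one_mul, pow_succ']

theorem tendsto_div_pow_of_recurrence (hC : Tendsto C (𝓝[≠] 0) (𝓝 1))
    (hbdd : ∀ k, I k =O[𝓝[≠] 0] (fun _ => (1:ℝ)))
    (hrec : ∀ k, ∀ᶠ s in 𝓝[≠] (0:ℝ), (m:ℝ) ^ 2 * I k s = C s ^ 2 * (k ^ 2 * (1 - s / 2) * I k s +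
      k * (k + 1) * s / 4 * I (k + 2) s + k * (k - 1) * s / 4 * I (k - 2) s))
    {L : ℝ} (hdiag : Tendsto (I m) (𝓝[≠] 0) (𝓝 L)) (j k : ℕ) (hk : 1 ≤ k) (hm : k + 2 * j = m) :
    Tendsto (fun s => I k s / s ^ j) (𝓝[≠] 0)
      (𝓝 (L * (((2:ℝ) ^ (4 * j))⁻¹ * (Nat.choose (k + j - 1) j : ℝ)))) := by
  induction j generalizing k with
  | zero =>
    obtain rfl : k = m := by omega
    simpa using hdiag
  | succ j ih =>
    obtain ⟨Q, hQ, h⟩ := eventually_eq_of_recurrence hC hrec (show k < m by omega)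
    have hlow : Tendsto (fun s => (k:ℝ) * (k - 1) * (I (k - 2) s / s ^ j)) (𝓝[≠] 0) (𝓝 0) := by
      obtain rfl | hk2 : k = 1 ∨ 2 ≤ k := by omega
      · simp
      · have hO := isBigO_of_recurrence hC hbdd hrec (j + 1) (k - 2) (by omega)
        have : (fun s : ℝ => s ^ (j + 1)) =o[𝓝[≠] 0] (fun s => s ^ j) :=
          (isLittleO_pow_pow (lt_add_one j)).mono nhdsWithin_le_nhds
        simpa using (hO.trans_isLittleO this).tendsto_div_nhds_zero.const_mul ((k:ℝ) * (k - 1))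
    have hup := (ih (k + 2) (by omega) (by omega)).const_mul ((k:ℝ) * (k + 1))
    have hlim := hQ.mul (hup.add hlow)
    have hval : (4 * ((m:ℝ) ^ 2 - k ^ 2))⁻¹ * ((k:ℝ) * (k + 1) *
        (L * (((2:ℝ) ^ (4 * j))⁻¹ * (Nat.choose (k + 2 + j - 1) j : ℝ))) + 0) =
        L * (((2:ℝ) ^ (4 * (j + 1)))⁻¹ * (Nat.choose (k + (j + 1) - 1) (j + 1) : ℝ)) := by
      obtain ⟨k, rfl⟩ : ∃ i, k = i + 1 := ⟨k - 1, by omega⟩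
      have h1 : (k + 1 + 2 + j - 1).choose j * ((k + 1) * (k + 2)) =
          (k + 1 + (j + 1) - 1).choose (j + 1) * ((j + 1) * (k + j + 2)) := by
        have e1 : k + 1 + 2 + j - 1 = (k + 2) + j := by omega
        have e2 : k + 1 + (j + 1) - 1 = k + (j + 1) := by omega
        have f1 := Nat.add_choose_mul_factorial_mul_factorial (k + 2) j
        have f2 := Nat.add_choose_mul_factorial_mul_factorial k (j + 1)
        rw [e1, e2]
        refine Nat.eq_of_mul_eq_mul_right
          (Nat.mul_pos k.factorial_pos j.factorial_pos) ?_
        have e3 : k + 2 + j = k + (j + 1) + 1 := by omega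
        rw [e3] at f1 ⊢
        simp only [Nat.factorial_succ] at f1 f2 ⊢
        linear_combination f1 - (k + j + 2) * f2
      have h2 : (((k + 1 + 2 + j - 1).choose j : ℝ)) * ((k + 1) * (k + 2)) =
          (k + 1 + (j + 1) - 1).choose (j + 1) * ((j + 1) * (k + j + 2)) := by exact_mod_cast h1
      have hm' : (m:ℝ) = k + 1 + 2 * (j + 1) := by rw [← hm]; push_cast; ring
      have hne : 4 * ((m:ℝ) ^ 2 - ((k + 1 : ℕ) : ℝ) ^ 2) = 16 * ((j + 1) * (k + j + 2)) := by
        rw [hm']; push_cast; ring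
      rw [hne, mul_add 4 j 1, pow_add]
      push_cast
      field_simp
      linear_combination 16 * L * h2
    rw [hval] at hlim
    refine hlim.congr' ?_
    filter_upwards [h, self_mem_nhdsWithin] with s hs (hs0 : s ≠ 0)
    rw [hs, pow_succ]
    field_simp

end Recurrence
theorem one_sub_mul_sin_sq_pos {s : ℝ} (hs : |s| < 1) (τ : ℝ) : 0 < 1 - s * Real.sin τ ^ 2 := by
  have h1 := Real.sin_sq_le_one τ
  have h2 := sq_nonneg (Real.sin τ)
  have h3 := abs_lt.1 hs
  nlinarith

/-- If `G` solves the pendulum equation `G' = C √(1 - s sin² G)`, the Fourier coefficients of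
`cos (k G)` satisfy a three-term recurrence in `k`. -/
theorem integral_cos_mul_cos_recurrence {G : ℝ → ℝ} {C s : ℝ} (hs : |s| < 1)
    (hG : ∀ θ, HasDerivAt G (C * √(1 - s * Real.sin (G θ) ^ 2)) θ)
    (hπ : G π = π) (hπ' : G (-π) = -π) (m k : ℕ) :
    (m:ℝ) ^ 2 * (∫ θ in (-π)..π, Real.cos (k * G θ) * Real.cos (m * θ)) =
      C ^ 2 * (k ^ 2 * (1 - s / 2) * (∫ θ in (-π)..π, Real.cos (k * G θ) * Real.cos (m * θ)) +
        k * (k + 1) * s / 4 *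
          (∫ θ in (-π)..π, Real.cos ((k + 2 : ℕ) * G θ) * Real.cos (m * θ)) +
        k * (k - 1) * s / 4 *
          (∫ θ in (-π)..π, Real.cos ((k - 2 : ℕ) * G θ) * Real.cos (m * θ))) := by
  have hGc : Continuous G := continuous_iff_continuousAt.2 fun θ => (hG θ).continuousAt
  have hpos := fun θ => one_sub_mul_sin_sq_pos hs (G θ)
  have hD : ∀ θ, HasDerivAt (fun θ => C * √(1 - s * Real.sin (G θ) ^ 2))
      (-(C ^ 2 * s * Real.sin (G θ) * Real.cos (G θ))) θ := fun θ => by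
    have hne : √(1 - s * Real.sin (G θ) ^ 2) ≠ 0 := (Real.sqrt_pos.2 (hpos θ)).ne'
    convert! ((((((hG θ).sin).pow 2).const_mul s).const_sub 1).sqrt (hpos θ).ne').const_mul C using 1
    simp only [Pi.pow_apply]
    field_simp
    ring
  have hu : ∀ (l : ℕ) θ, HasDerivAt (fun θ => (l:ℝ) * θ) l θ := fun l θ => by
    simpa using (hasDerivAt_id θ).const_mul (l:ℝ)
  have hW : ∀ θ, HasDerivAt
      (fun θ => -(k * (Real.sin (k * G θ) * (C * √(1 - s * Real.sin (G θ) ^ 2)))) * Real.cos (m * θ)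
        + m * (Real.cos (k * G θ) * Real.sin (m * θ)))
      ((m:ℝ) ^ 2 * (Real.cos (k * G θ) * Real.cos (m * θ)) -
        C ^ 2 * (k ^ 2 * (1 - s / 2) * (Real.cos (k * G θ) * Real.cos (m * θ)) +
        k * (k + 1) * s / 4 * (Real.cos ((k + 2 : ℕ) * G θ) * Real.cos (m * θ)) +
        k * (k - 1) * s / 4 * (Real.cos ((k - 2 : ℕ) * G θ) * Real.cos (m * θ)))) θ := fun θ => by
    have hk := (hG θ).const_mul (k:ℝ)
    convert! ((((hk.sin.mul (hD θ)).const_mul (k:ℝ)).neg).mul (hu m θ).cos).add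
      ((hk.cos.mul (hu m θ).sin).const_mul (m:ℝ)) using 1
    have hsq := Real.sq_sqrt (hpos θ).le
    have hup : Real.cos ((k + 2 : ℕ) * G θ) = Real.cos (k * G θ) * Real.cos (2 * G θ) -
        Real.sin (k * G θ) * Real.sin (2 * G θ) := by
      rw [← Real.cos_add]; push_cast; ring_nf
    have hlow : (k:ℝ) * (k - 1) * Real.cos ((k - 2 : ℕ) * G θ) =
        k * (k - 1) * (Real.cos (k * G θ) * Real.cos (2 * G θ) +
          Real.sin (k * G θ) * Real.sin (2 * G θ)) := by
      obtain rfl | rfl | h2 : k = 0 ∨ k = 1 ∨ 2 ≤ k := by omega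
      · simp
      · simp
      · rw [← Real.cos_sub, Nat.cast_sub h2]; push_cast; ring_nf
    rw [Real.sin_two_mul, Real.cos_two_mul, Real.cos_sq'] at hup hlow
    rw [hup]
    simp only [Pi.mul_apply, Pi.neg_apply]
    linear_combination (-(C ^ 2 * s / 4 * Real.cos (m * θ))) * hlow +
      (k ^ 2 * C ^ 2 * Real.cos (k * G θ) * Real.cos (m * θ)) * hsq
  have hi : ∀ l : ℕ, IntervalIntegrable (fun θ => Real.cos (l * G θ) * Real.cos (m * θ))
      volume (-π) π := fun l => Continuous.intervalIntegrable (by fun_prop) _ _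
  have key := intervalIntegral.integral_eq_sub_of_hasDerivAt (a := -π) (b := π)
    (fun θ _ => hW θ) (Continuous.intervalIntegrable (by fun_prop) _ _)
  rw [intervalIntegral.integral_sub ((hi k).const_mul _) (((((hi k).const_mul _).add
    ((hi _).const_mul _)).add ((hi _).const_mul _)).const_mul _), intervalIntegral.integral_const_mul,
    intervalIntegral.integral_const_mul, intervalIntegral.integral_add (((hi k).const_mul _).add
    ((hi _).const_mul _)) ((hi _).const_mul _), intervalIntegral.integral_add ((hi k).const_mul _)
    ((hi _).const_mul _), intervalIntegral.integral_const_mul, intervalIntegral.integral_const_mul,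
    intervalIntegral.integral_const_mul, hπ, hπ'] at key
  simp only [mul_neg, Real.sin_neg, Real.sin_nat_mul_pi] at key
  simp only [neg_zero, zero_mul, mul_zero, add_zero, sub_zero] at key
  linarith

theorem continuous_ellipticIntegrand {s : ℝ} (hs : |s| < 1) :
    Continuous fun τ => (1 - s * Real.sin τ ^ 2) ^ (-(1:ℝ)/2) :=
  Continuous.rpow_const (by fun_prop) fun τ => Or.inl (one_sub_mul_sin_sq_pos hs τ).ne'

theorem completeEllipticIntegral_pos {s : ℝ} (hs : |s| < 1) :
    0 < ∫ τ in (0:ℝ)..(π/2), (1 - s * Real.sin τ ^ 2) ^ (-(1:ℝ)/2) :=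
  intervalIntegral.intervalIntegral_pos_of_pos
    ((continuous_ellipticIntegrand hs).intervalIntegrable _ _)
    (fun τ => Real.rpow_pos_of_pos (one_sub_mul_sin_sq_pos hs τ) _) (by positivity)

theorem hasDerivAt_actionAngle {s : ℝ} (hs : |s| < 1) (φ : ℝ) :
    HasDerivAt (actionAngle s) ((π / 2) * (1 - s * Real.sin φ ^ 2) ^ (-(1:ℝ)/2) /
      ∫ τ in (0:ℝ)..(π/2), (1 - s * Real.sin τ ^ 2) ^ (-(1:ℝ)/2)) φ := by
  have hc := continuous_ellipticIntegrand hs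
  exact ((intervalIntegral.integral_hasDerivAt_right (hc.intervalIntegrable 0 φ)
    hc.stronglyMeasurable.stronglyMeasurableAtFilter hc.continuousAt).const_mul _).div_const _

theorem deriv_actionAngle_pos {s : ℝ} (hs : |s| < 1) (φ : ℝ) :
    0 < (π / 2) * (1 - s * Real.sin φ ^ 2) ^ (-(1:ℝ)/2) /
      ∫ τ in (0:ℝ)..(π/2), (1 - s * Real.sin τ ^ 2) ^ (-(1:ℝ)/2) := by
  have h1 := completeEllipticIntegral_pos hs
  have h2 := Real.rpow_pos_of_pos (one_sub_mul_sin_sq_pos hs φ) (-(1:ℝ)/2)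
  positivity

theorem actionAngle_injective {s : ℝ} (hs : |s| < 1) : Function.Injective (actionAngle s) :=
  (strictMono_of_hasDerivAt_pos (hasDerivAt_actionAngle hs) (deriv_actionAngle_pos hs)).injective

theorem actionAngle_neg (s φ : ℝ) : actionAngle s (-φ) = -actionAngle s φ := by
  have h := intervalIntegral.integral_comp_neg (a := 0) (b := φ)
    (fun τ => (1 - s * Real.sin τ ^ 2) ^ (-(1:ℝ)/2))
  simp only [Real.sin_neg, neg_sq, neg_zero] at h
  unfold actionAngle
  rw [intervalIntegral.integral_symm, ← h]
  ring

theorem actionAngle_pi {s : ℝ} (hs : |s| < 1) : actionAngle s π = π := by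
  have hc := continuous_ellipticIntegrand hs
  have h := intervalIntegral.integral_comp_sub_left (a := 0) (b := π / 2)
    (fun τ => (1 - s * Real.sin τ ^ 2) ^ (-(1:ℝ)/2)) π
  simp only [Real.sin_pi_sub, sub_zero, sub_half] at h
  have h1 := completeEllipticIntegral_pos hs
  unfold actionAngle
  rw [← intervalIntegral.integral_add_adjacent_intervals (hc.intervalIntegrable 0 (π / 2))
    (hc.intervalIntegrable (π / 2) π), ← h, ← two_mul, mul_left_comm, mul_div_assoc,
    mul_div_cancel_right₀ _ h1.ne', mul_div_cancel₀ _ two_ne_zero]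
theorem contDiff_of_actionAngle_eq {χ : ℝ → ℝ} (hχ : ContDiff ℝ ∞ χ) (hχ1 : ∀ s, |χ s| < 1)
    {γ : ℝ × ℝ → ℝ} (hγ : ∀ p, actionAngle (χ p.1) (γ p) = p.2) : ContDiff ℝ ∞ γ := by
  have hH : ContDiff ℝ ∞ fun p : ℝ × ℝ => (1 - χ p.1 * Real.sin p.2 ^ 2) ^ (-(1:ℝ)/2) :=
    ContDiff.rpow_const_of_ne (by fun_prop) fun p => (one_sub_mul_sin_sq_pos (hχ1 p.1) p.2).ne'
  have hN : ContDiff ℝ ∞ fun p : ℝ × ℝ =>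
      ∫ τ in (0:ℝ)..p.2, (1 - χ p.1 * Real.sin τ ^ 2) ^ (-(1:ℝ)/2) :=
    contDiff_infty.2 fun n => contDiff_parametric_primitive (hH.of_le (by exact_mod_cast le_top))
  have hf : ContDiff ℝ ∞ fun p : ℝ × ℝ => actionAngle (χ p.1) p.2 := by
    refine ContDiff.div (contDiff_const.mul hN) (hN.comp (contDiff_fst.prodMk
      (contDiff_const (c := π / 2)))) fun p => (completeEllipticIntegral_pos (hχ1 p.1)).ne'
  let F : (ℝ × ℝ) × ℝ → ℝ := fun q => actionAngle (χ q.1.1) q.2 - q.1.2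
  have hF : ContDiff ℝ ∞ F :=
    (hf.comp (by fun_prop : ContDiff ℝ ∞ fun q : (ℝ × ℝ) × ℝ => (q.1.1, q.2))).sub (by fun_prop)
  refine contDiff_iff_contDiffAt.2 fun p => ?_
  have hFp : ContDiffAt ℝ ∞ F (p, γ p) := hF.contDiffAt
  have hd := hasDerivAt_actionAngle (hχ1 p.1) (γ p)
  have hd' := deriv_actionAngle_pos (hχ1 p.1) (γ p)
  set D := (π / 2) * (1 - χ p.1 * Real.sin (γ p) ^ 2) ^ (-(1:ℝ)/2) /
      ∫ τ in (0:ℝ)..(π/2), (1 - χ p.1 * Real.sin τ ^ 2) ^ (-(1:ℝ)/2)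
  have hinv : (fderiv ℝ F (p, γ p) ∘L .inr ℝ (ℝ × ℝ) ℝ).IsInvertible := by
    refine ⟨ContinuousLinearEquiv.unitsEquivAut ℝ (Units.mk0 D hd'.ne'), ?_⟩
    ext
    have h1 : HasDerivAt (fun φ => F (p, φ)) (fderiv ℝ F (p, γ p) ((0 : ℝ × ℝ), (1 : ℝ))) (γ p) :=
      (hF.differentiable (by simp) (p, γ p)).hasFDerivAt.comp_hasDerivAt (γ p)
        ((hasDerivAt_const (γ p) p).prodMk (hasDerivAt_id (γ p)))
    simpa using (hd.sub_const p.2).unique h1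
  refine (hFp.contDiffAt_implicitFunction (by simp) hinv).congr_of_eventuallyEq ?_
  filter_upwards [hFp.eventually_apply_implicitFunction (by simp) hinv] with q hq
  refine actionAngle_injective (hχ1 q.1) ?_
  rw [hγ q]
  simp only [F, hγ p, sub_self] at hq
  linarith

theorem hasDerivAt_of_actionAngle_eq {s : ℝ} (hs : |s| < 1) {G : ℝ → ℝ} (hG : Continuous G)
    (h : ∀ θ, actionAngle s (G θ) = θ) (θ : ℝ) :
    HasDerivAt G ((∫ τ in (0:ℝ)..(π/2), (1 - s * Real.sin τ ^ 2) ^ (-(1:ℝ)/2)) / (π / 2) *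
      √(1 - s * Real.sin (G θ) ^ 2)) θ := by
  convert! HasDerivAt.of_local_left_inverse hG.continuousAt (hasDerivAt_actionAngle hs (G θ))
    (deriv_actionAngle_pos hs (G θ)).ne' (Eventually.of_forall h) using 1
  rw [inv_div, neg_div, Real.rpow_neg (one_sub_mul_sin_sq_pos hs _).le, ← Real.sqrt_eq_rpow]
  rw [div_mul_eq_div_div, div_inv_eq_mul]

theorem exists_contDiff_clamp {ε : ℝ} (hε : 0 < ε) :
    ∃ χ : ℝ → ℝ, ContDiff ℝ ∞ χ ∧ (∀ s, |χ s| < ε) ∧ ∀ᶠ s in 𝓝 0, χ s = s := by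
  let b : ContDiffBump (0:ℝ) := ⟨ε / 3, ε / 2, by positivity, by linarith⟩
  refine ⟨fun s => b s * s, b.contDiff.mul contDiff_id, fun s => ?_, ?_⟩
  · rw [abs_mul, abs_of_nonneg b.nonneg]
    by_cases hs : |s| < ε
    · exact (mul_le_of_le_one_left (abs_nonneg s) b.le_one).trans_lt hs
    · rw [b.zero_of_le_dist, zero_mul]
      · exact hε
      · rw [Real.dist_eq, sub_zero]
        change ε / 2 ≤ |s|
        linarith
  · filter_upwards [b.eventuallyEq_one] with s hs
    simp [hs]

theorem integral_cos_nat_mul_sq {m : ℕ} (hm : m ≠ 0) :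
    ∫ θ in (-π)..π, Real.cos (m * θ) * Real.cos (m * θ) = π := by
  have hm' : (m:ℝ) ≠ 0 := Nat.cast_ne_zero.2 hm
  have h := intervalIntegral.integral_comp_mul_left (a := -π) (b := π)
    (fun x => Real.cos x ^ 2) hm'
  simp_rw [← sq]
  rw [h, integral_cos_sq]
  simp [Real.sin_nat_mul_pi]
  field_simp

theorem xi_diag (ε : ℝ) (hε0 : 0 < ε) (hε1 : ε < 1) (g : ℝ → ℝ → ℝ)
    (hg0 : ∀ θ : ℝ, g 0 θ = θ)
    (hsmooth : ∀ θ : ℝ, ContDiffOn ℝ ∞ (fun s => g s θ) (Set.Ioo (-ε) ε))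
    (hinv : ∀ θ : ℝ, ∀ s : ℝ, |s| < ε → actionAngle s (g s θ) = θ)
    (j k : ℕ) (hj : 1 ≤ j) (hk : 1 ≤ k) :
    (1 / (π * (Nat.factorial j : ℝ))) *
      ∫ θ in (-π)..π,
        iteratedDeriv j (fun s => Real.cos (k * g s θ)) 0 * Real.cos ((k + 2 * j) * θ)
      = ((2:ℝ) ^ (4 * j))⁻¹ * (Nat.choose (k + j - 1) j : ℝ) := by
  obtain ⟨χ, hχ, hχε, hχ0⟩ := exists_contDiff_clamp hε0
  have hχ1 : ∀ s, |χ s| < 1 := fun s => (hχε s).trans hε1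
  have hγ : ContDiff ℝ ∞ fun p : ℝ × ℝ => g (χ p.1) p.2 :=
    contDiff_of_actionAngle_eq hχ hχ1 fun p => hinv p.2 _ (hχε p.1)
  obtain ⟨m, hm⟩ : ∃ m, k + 2 * j = m := ⟨_, rfl⟩
  have hmr : (k:ℝ) + 2 * j = m := by exact_mod_cast hm
  let H : ℕ → ℝ × ℝ → ℝ := fun l p => Real.cos (l * g (χ p.1) p.2) * Real.cos (m * p.2)
  have hH : ∀ l, ContDiff ℝ ∞ (H l) := fun l =>
    (contDiff_const.mul hγ).cos.mul (contDiff_const.mul contDiff_snd).cos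
  let I : ℕ → ℝ → ℝ := fun l s => ∫ θ in (-π)..π, H l (s, θ)
  have hI : ∀ l (n : ℕ), ContDiff ℝ n (I l) := fun l n =>
    contDiff_parametric_integral ((hH l).of_le (by exact_mod_cast le_top)) _ _
  have hI0 : ∀ l, Tendsto (I l) (𝓝[≠] 0) (𝓝 (I l 0)) := fun l =>
    ((hI l 0).continuous.tendsto 0).mono_left nhdsWithin_le_nhds
  let C : ℝ → ℝ := fun s =>
    (∫ τ in (0:ℝ)..(π/2), (1 - χ s * Real.sin τ ^ 2) ^ (-(1:ℝ)/2)) / (π / 2)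
  have hC : Tendsto C (𝓝[≠] 0) (𝓝 1) := by
    have hcont : Continuous C := by
      have hint : ContDiff ℝ 0 fun p : ℝ × ℝ => (1 - χ p.1 * Real.sin p.2 ^ 2) ^ (-(1:ℝ)/2) :=
        ContDiff.rpow_const_of_ne ((contDiff_const.sub ((hχ.comp contDiff_fst).mul
          (contDiff_snd.sin.pow 2))).of_le (by simp))
          fun p => (one_sub_mul_sin_sq_pos (hχ1 p.1) p.2).ne'
      exact (contDiff_parametric_integral (n := 0) hint 0 (π / 2)).continuous.div_const _
    refine (hcont.tendsto' 0 1 ?_).mono_left nhdsWithin_le_nhds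
    have : π / 2 ≠ 0 := by positivity
    simp [C, hχ0.self_of_nhds, this]
  have hrec : ∀ l, ∀ᶠ s in 𝓝[≠] (0:ℝ), (m:ℝ) ^ 2 * I l s =
      C s ^ 2 * (l ^ 2 * (1 - s / 2) * I l s + l * (l + 1) * s / 4 * I (l + 2) s +
        l * (l - 1) * s / 4 * I (l - 2) s) := fun l => by
    filter_upwards [nhdsWithin_le_nhds hχ0] with s hs
    have hfix : g (χ s) π = π := actionAngle_injective (hχ1 s) <| by
      rw [hinv π _ (hχε s), actionAngle_pi (hχ1 s)]
    have hfix' : g (χ s) (-π) = -π := actionAngle_injective (hχ1 s) <| by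
      rw [hinv _ _ (hχε s), actionAngle_neg, actionAngle_pi (hχ1 s)]
    have hode := hasDerivAt_of_actionAngle_eq (hχ1 s) (G := g (χ s))
      (hγ.continuous.comp (by fun_prop : Continuous fun θ : ℝ => (s, θ)))
      fun θ => hinv θ _ (hχε s)
    have h : (m:ℝ) ^ 2 * I l s =
        C s ^ 2 * (l ^ 2 * (1 - χ s / 2) * I l s + l * (l + 1) * χ s / 4 * I (l + 2) s +
          l * (l - 1) * χ s / 4 * I (l - 2) s) :=
      integral_cos_mul_cos_recurrence (hχ1 s) hode hfix hfix' m l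
    rwa [hs] at h
  have hdiag : Tendsto (I m) (𝓝[≠] 0) (𝓝 π) := by
    convert hI0 m using 2
    simp only [I, H, hχ0.self_of_nhds, hg0]
    exact (integral_cos_nat_mul_sq (by omega)).symm
  have hlim := tendsto_div_pow_of_recurrence hC (fun l => (hI0 l).isBigO_one ℝ) hrec hdiag j k hk hm
  have hderiv := iteratedDeriv_eq_of_tendsto_div_pow (hI k j) hlim
  rw [iteratedDeriv_parametric_integral (hH k)] at hderiv
  have hcoeff : ∀ θ, iteratedDeriv j (fun s => H k (s, θ)) 0 =
      iteratedDeriv j (fun s => Real.cos (k * g s θ)) 0 * Real.cos ((k + 2 * j) * θ) := fun θ => by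
    rw [hmr, ← iteratedDeriv_mul_const_field]
    refine Filter.EventuallyEq.iteratedDeriv_eq j ?_
    filter_upwards [hχ0] with s hs
    simp only [H, hs]
  simp_rw [hcoeff] at hderiv
  rw [hderiv]
  have := j.factorial_ne_zero
  field_simp
end

section
/- Let q₀ ≥ 3 be an integer and let q be a prime with q ≥ 2q₀ such that every prime divisor of (q−1)/2 is at least q₀. Then the smallest subgroup of the unit group (ℤ/qℤ)* containing the residues of the odd numbers 1, 3, 5, …, 2⌊q/q₀⌋ − 1 and closed under negation (x ↦ −x) is all of (ℤ/qℤ)*; that is, q is q₀-B-good. -/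
/-- A subgroup of `(ZMod q)ˣ` containing `-1` has index dividing `(q - 1) / 2`. -/
theorem ZMod.index_dvd_half_of_neg_one_mem {q : ℕ} [Fact q.Prime] (hq : 2 < q)
    (H : Subgroup (ZMod q)ˣ) (h : (-1 : (ZMod q)ˣ) ∈ H) : H.index ∣ (q - 1) / 2 := by
  have : Fact (2 < q) := ⟨hq⟩
  have hne : (-1 : (ZMod q)ˣ) ≠ 1 := fun e => ZMod.neg_one_ne_one (congrArg Units.val e)
  have hord : orderOf (-1 : (ZMod q)ˣ) = 2 := orderOf_eq_prime (by simp) hne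
  obtain ⟨k, hk⟩ : 2 ∣ Nat.card H := hord ▸ H.orderOf_dvd_natCard h
  have hmul := H.card_mul_index
  rw [Nat.card_eq_fintype_card (α := (ZMod q)ˣ), ZMod.card_units, hk] at hmul
  exact ⟨k, by rw [← hmul, mul_assoc, Nat.mul_div_cancel_left _ two_pos, mul_comm]⟩

/-- A subgroup of `(ZMod q)ˣ` containing `-1` and the first `m` odd numbers, all less than `q`,
has more than `m` elements. -/
theorem ZMod.lt_card_of_odd_mem {q m : ℕ} [Fact q.Prime] (hq : 2 < q) (hm : 2 * m ≤ q)
    (H : Subgroup (ZMod q)ˣ) (h : (-1 : (ZMod q)ˣ) ∈ H)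
    (hodd : ∀ u : (ZMod q)ˣ,
      (∃ n : ℕ, 1 ≤ n ∧ n ≤ m ∧ (u : ZMod q) = ((2 * n - 1 : ℕ) : ZMod q)) → u ∈ H) :
    m < Nat.card H := by
  classical
  have hp : q.Prime := Fact.out
  have hqodd : q % 2 = 1 := hp.eq_two_or_odd.resolve_left hq.ne'
  set S : Finset ℕ := insert (q - 1) ((Finset.Icc 1 m).image fun n => 2 * n - 1) with hS
  have hcard : S.card = m + 1 := by
    rw [hS, Finset.card_insert_of_notMem, Finset.card_image_of_injOn, Nat.card_Icc,
      Nat.add_sub_cancel]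
    · intro a ha b hb hab
      simp only [Finset.coe_Icc, Set.mem_Icc] at ha hb hab
      omega
    · simp only [Finset.mem_image, Finset.mem_Icc, not_exists, not_and]
      intro n hn
      omega
  have hsub : S ⊆ (Finset.univ : Finset H).image fun u : H => ((u : (ZMod q)ˣ) : ZMod q).val := by
    intro a ha
    simp only [Finset.mem_image, Finset.mem_univ, true_and]
    rw [hS, Finset.mem_insert, Finset.mem_image] at ha
    rcases ha with rfl | ⟨n, hn, rfl⟩
    · refine ⟨⟨-1, h⟩, ?_⟩
      obtain ⟨k, rfl⟩ : ∃ k, q = k + 1 := ⟨q - 1, by omega⟩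
      simp [ZMod.val_neg_one]
    · rw [Finset.mem_Icc] at hn
      have hne : ((2 * n - 1 : ℕ) : ZMod q) ≠ 0 := by
        rw [Ne, ZMod.natCast_eq_zero_iff]
        exact Nat.not_dvd_of_pos_of_lt (by omega) (by omega)
      exact ⟨⟨Units.mk0 _ hne, hodd _ ⟨n, hn.1, hn.2, rfl⟩⟩,
        ZMod.val_cast_of_lt (by omega)⟩
  have := (Finset.card_le_card hsub).trans Finset.card_image_le
  rw [hcard, Finset.card_univ, ← Nat.card_eq_fintype_card] at this
  exact this

theorem q0_B_good_of_no_small_prime_divisor (q₀ q : ℕ) (hq₀ : 3 ≤ q₀) (hq : q.Prime)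
    (hqq : 2 * q₀ ≤ q)
    (hdiv : ∀ r : ℕ, r.Prime → r ∣ (q - 1) / 2 → q₀ ≤ r)
    (H : Subgroup (ZMod q)ˣ) (hneg : ∀ x ∈ H, -x ∈ H)
    (hcont : ∀ u : (ZMod q)ˣ,
      (∃ n : ℕ, 1 ≤ n ∧ n ≤ q / q₀ ∧ (u : ZMod q) = ((2 * n - 1 : ℕ) : ZMod q)) → u ∈ H) :
    H = ⊤ := by
  have : Fact q.Prime := ⟨hq⟩
  have h : (-1 : (ZMod q)ˣ) ∈ H := hneg 1 H.one_mem
  by_contra htop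
  have hindex : H.index ≠ 1 := fun e => htop (Subgroup.index_eq_one.mp e)
  have hle : q₀ ≤ H.index :=
    (hdiv _ (Nat.minFac_prime hindex) ((Nat.minFac_dvd _).trans
      (ZMod.index_dvd_half_of_neg_one_mem (by omega) H h))).trans
      (Nat.minFac_le (Nat.pos_of_ne_zero Subgroup.index_ne_zero_of_finite))
  have hm : 2 * (q / q₀) ≤ q :=
    (Nat.mul_le_mul_right _ (by omega)).trans (Nat.mul_div_le q q₀)
  have hcard : q / q₀ < Nat.card H := ZMod.lt_card_of_odd_mem (by omega) hm H h hcont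
  have hmul := H.card_mul_index
  rw [Nat.card_eq_fintype_card (α := (ZMod q)ˣ), ZMod.card_units] at hmul
  have hlt : q < Nat.card H * q₀ := (Nat.div_lt_iff_lt_mul (by omega)).mp hcard
  have := Nat.mul_le_mul_left (Nat.card H) hle
  omega
end
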